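/- Let A ∈ ℝ^{n×n}, B ∈ ℝ^{n×q}, and let Q ∈ ℝ^{n×n} be a symmetric invertible matrix satisfying the Lyapunov equation A Q + Q Aᵀ = −B Bᵀ. Define ρ : ℝⁿ → ℝ by ρ(x) = exp(−(1/2) xᵀ Q^{−1} x). Then ρ is a steady-state solution of the Fokker–Planck equation for the linear SDE dX = AX dt + B dW: for every x ∈ ℝⁿ, −Σ_{j=1}^n ∂/∂x_j [ (A x)_j ρ(x) ] + (1/2) Σ_{j,k=1}^n (B Bᵀ)_{jk} ∂²ρ/∂x_j ∂x_k (x) = 0. -/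

import Mathlib

open Matrix

section GaussianDerivatives

variable {ι : Type*} [Fintype ι]

lemma hasFDerivAt_mulVec_apply {m : Type*} [Fintype m] (M : Matrix m ι ℝ) (i : m) (x : ι → ℝ) :
    HasFDerivAt (fun y : ι → ℝ => (M *ᵥ y) i)
      ((ContinuousLinearMap.proj (R := ℝ) (φ := fun _ : m => ℝ) i).comp
        (LinearMap.toContinuousLinearMap M.mulVecLin)) x :=
  ContinuousLinearMap.hasFDerivAt
    ((ContinuousLinearMap.proj (R := ℝ) (φ := fun _ : m => ℝ) i).comp
      (LinearMap.toContinuousLinearMap M.mulVecLin))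

lemma differentiable_mulVec_apply {m : Type*} [Fintype m] (M : Matrix m ι ℝ) (i : m) :
    Differentiable ℝ (fun y : ι → ℝ => (M *ᵥ y) i) :=
  fun x => (hasFDerivAt_mulVec_apply M i x).differentiableAt

lemma fderiv_mulVec_apply {m : Type*} [Fintype m] (M : Matrix m ι ℝ) (i : m) (x v : ι → ℝ) :
    fderiv ℝ (fun y : ι → ℝ => (M *ᵥ y) i) x v = (M *ᵥ v) i := by
  rw [(hasFDerivAt_mulVec_apply M i x).fderiv]
  rfl

lemma hasFDerivAt_dotProduct_mulVec (P : Matrix ι ι ℝ) (x : ι → ℝ) :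
    HasFDerivAt (fun y : ι → ℝ => y ⬝ᵥ (P *ᵥ y))
      (∑ i, (x i • ((ContinuousLinearMap.proj (R := ℝ) (φ := fun _ : ι => ℝ) i).comp
          (LinearMap.toContinuousLinearMap P.mulVecLin)) +
        (P *ᵥ x) i • ContinuousLinearMap.proj (R := ℝ) (φ := fun _ : ι => ℝ) i)) x :=
  HasFDerivAt.fun_sum fun i _ => (hasFDerivAt_apply i x).mul (hasFDerivAt_mulVec_apply P i x)

lemma differentiable_exp_quadraticForm (P : Matrix ι ι ℝ) :
    Differentiable ℝ (fun y : ι → ℝ => Real.exp (-(1 / 2) * (y ⬝ᵥ (P *ᵥ y)))) :=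
  fun x => (((hasFDerivAt_dotProduct_mulVec P x).const_mul (-(1 / 2))).exp).differentiableAt

lemma fderiv_exp_quadraticForm {P : Matrix ι ι ℝ} (hP : P.IsSymm) (x v : ι → ℝ) :
    fderiv ℝ (fun y : ι → ℝ => Real.exp (-(1 / 2) * (y ⬝ᵥ (P *ᵥ y)))) x v =
      -((v ⬝ᵥ (P *ᵥ x)) * Real.exp (-(1 / 2) * (x ⬝ᵥ (P *ᵥ x)))) := by
  have hsymm : x ⬝ᵥ (P *ᵥ v) = v ⬝ᵥ (P *ᵥ x) := by
    rw [dotProduct_mulVec, ← mulVec_transpose, hP.eq, dotProduct_comm]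
  have hsum : (∑ i, (x i • ((ContinuousLinearMap.proj (R := ℝ) (φ := fun _ : ι => ℝ) i).comp
          (LinearMap.toContinuousLinearMap P.mulVecLin)) +
        (P *ᵥ x) i • ContinuousLinearMap.proj (R := ℝ) (φ := fun _ : ι => ℝ) i)) v =
      x ⬝ᵥ (P *ᵥ v) + v ⬝ᵥ (P *ᵥ x) := by
    simp [Finset.sum_add_distrib, dotProduct, mul_comm]
  rw [(((hasFDerivAt_dotProduct_mulVec P x).const_mul (-(1 / 2))).exp).fderiv,
    _root_.smul_apply, _root_.smul_apply, hsum, hsymm]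
  simp only [smul_eq_mul]
  ring

lemma fderiv_mulVec_mul_exp_quadraticForm [DecidableEq ι] {m : Type*} [Fintype m]
    (M : Matrix m ι ℝ) {P : Matrix ι ι ℝ} (hP : P.IsSymm) (i : m) (j : ι) (x : ι → ℝ) :
    fderiv ℝ (fun y : ι → ℝ => (M *ᵥ y) i * Real.exp (-(1 / 2) * (y ⬝ᵥ (P *ᵥ y)))) x
        (Pi.single j 1) =
      (M i j - (M *ᵥ x) i * (P *ᵥ x) j) * Real.exp (-(1 / 2) * (x ⬝ᵥ (P *ᵥ x))) := by
  rw [fderiv_fun_mul (differentiable_mulVec_apply M i x) (differentiable_exp_quadraticForm P x),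
    _root_.add_apply, _root_.smul_apply, _root_.smul_apply,
    fderiv_exp_quadraticForm hP, fderiv_mulVec_apply, single_one_dotProduct, mulVec_single_one]
  simp only [smul_eq_mul, col_apply]
  ring

lemma fderiv_fderiv_exp_quadraticForm [DecidableEq ι] {P : Matrix ι ι ℝ} (hP : P.IsSymm)
    (j k : ι) (x : ι → ℝ) :
    fderiv ℝ (fun y : ι → ℝ =>
        fderiv ℝ (fun z : ι → ℝ => Real.exp (-(1 / 2) * (z ⬝ᵥ (P *ᵥ z)))) y (Pi.single k 1)) x
        (Pi.single j 1) =
      ((P *ᵥ x) k * (P *ᵥ x) j - P k j) * Real.exp (-(1 / 2) * (x ⬝ᵥ (P *ᵥ x))) := by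
  simp only [fderiv_exp_quadraticForm hP, single_one_dotProduct]
  rw [fderiv_fun_neg, _root_.neg_apply, fderiv_mulVec_mul_exp_quadraticForm P hP]
  ring

end GaussianDerivatives

section Lyapunov

variable {ι : Type*} [Fintype ι] [DecidableEq ι] {A Q D : Matrix ι ι ℝ}

lemma trace_mul_inv_of_lyapunov (hQ : IsUnit Q.det) (h : A * Q + Q * Aᵀ = -D) :
    (D * Q⁻¹).trace = -(2 * A.trace) := by
  rw [show D = -(A * Q + Q * Aᵀ) by rw [h, neg_neg], Matrix.neg_mul, Matrix.add_mul, trace_neg,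
    trace_add, Matrix.mul_assoc A, mul_nonsing_inv Q hQ, Matrix.mul_one, Matrix.trace_mul_comm,
    ← Matrix.mul_assoc, nonsing_inv_mul Q hQ, Matrix.one_mul, trace_transpose]
  ring

lemma dotProduct_inv_mulVec_of_lyapunov (hsymm : Q.IsSymm) (hQ : IsUnit Q.det)
    (h : A * Q + Q * Aᵀ = -D) (x : ι → ℝ) :
    (Q⁻¹ *ᵥ x) ⬝ᵥ (D *ᵥ (Q⁻¹ *ᵥ x)) = -(2 * ((A *ᵥ x) ⬝ᵥ (Q⁻¹ *ᵥ x))) := by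
  have hQx : Q *ᵥ (Q⁻¹ *ᵥ x) = x := by
    rw [mulVec_mulVec, mul_nonsing_inv Q hQ, one_mulVec]
  have hadj : (Q⁻¹ *ᵥ x) ⬝ᵥ (Q *ᵥ (Aᵀ *ᵥ (Q⁻¹ *ᵥ x))) = (A *ᵥ x) ⬝ᵥ (Q⁻¹ *ᵥ x) := by
    rw [dotProduct_mulVec, ← mulVec_transpose, hsymm.eq, hQx, dotProduct_mulVec,
      vecMul_transpose]
  rw [show D = -(A * Q + Q * Aᵀ) by rw [h, neg_neg], neg_mulVec, add_mulVec, ← mulVec_mulVec,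
    ← mulVec_mulVec, hQx, dotProduct_neg, dotProduct_add, hadj, dotProduct_comm (Q⁻¹ *ᵥ x)]
  ring

end Lyapunov

/-- If `Q` is symmetric, invertible and solves the Lyapunov
equation `A Q + Q Aᵀ = −B Bᵀ`, then the Gaussian density
`ρ(x) = exp(−(1/2) xᵀ Q⁻¹ x)` is a steady-state solution of the Fokker–Planck
equation of `dX = AX dt + B dW`:
`−Σⱼ ∂/∂xⱼ[(Ax)ⱼ ρ(x)] + (1/2) Σⱼₖ (BBᵀ)ⱼₖ ∂²ρ/∂xⱼ∂xₖ (x) = 0`. -/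
theorem gaussian_steady_state_fokker_planck {n q : ℕ}
    (A : Matrix (Fin n) (Fin n) ℝ) (B : Matrix (Fin n) (Fin q) ℝ)
    (Q : Matrix (Fin n) (Fin n) ℝ) (hQsymm : Q.IsSymm) (hQinv : IsUnit Q.det)
    (hlyap : A * Q + Q * Aᵀ = -(B * Bᵀ)) :
    ∀ x : Fin n → ℝ,
      -(∑ j, fderiv ℝ
          (fun y : Fin n → ℝ =>
            (A *ᵥ y) j * Real.exp (-(1 / 2) * (y ⬝ᵥ (Q⁻¹ *ᵥ y)))) x (Pi.single j 1))
        + (1 / 2) * ∑ j, ∑ k, (B * Bᵀ) j k *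
            fderiv ℝ
              (fun y : Fin n → ℝ =>
                fderiv ℝ (fun z : Fin n → ℝ =>
                  Real.exp (-(1 / 2) * (z ⬝ᵥ (Q⁻¹ *ᵥ z)))) y (Pi.single k 1))
              x (Pi.single j 1)
      = 0 := by
  intro x
  have hP : Q⁻¹.IsSymm := by
    rw [IsSymm, transpose_nonsing_inv, hQsymm.eq]
  have htr := trace_mul_inv_of_lyapunov hQinv hlyap
  have hquad := dotProduct_inv_mulVec_of_lyapunov hQsymm hQinv hlyap x
  simp only [fderiv_mulVec_mul_exp_quadraticForm A hP, fderiv_fderiv_exp_quadraticForm hP]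
  generalize B * Bᵀ = D at htr hquad ⊢
  set E := Real.exp (-(1 / 2) * (x ⬝ᵥ (Q⁻¹ *ᵥ x)))
  have hdrift : ∑ j, (A j j - (A *ᵥ x) j * (Q⁻¹ *ᵥ x) j) * E =
      (A.trace - (A *ᵥ x) ⬝ᵥ (Q⁻¹ *ᵥ x)) * E := by
    rw [← Finset.sum_mul, Finset.sum_sub_distrib]
    rfl
  have hdiffusion : ∑ j, ∑ k, D j k * (((Q⁻¹ *ᵥ x) k * (Q⁻¹ *ᵥ x) j - Q⁻¹ k j) * E) =
      ((Q⁻¹ *ᵥ x) ⬝ᵥ (D *ᵥ (Q⁻¹ *ᵥ x)) - (D * Q⁻¹).trace) * E := by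
    generalize Q⁻¹ *ᵥ x = p
    simp only [dotProduct, mulVec, trace, diag_apply, mul_apply, Finset.mul_sum,
      ← Finset.sum_sub_distrib, Finset.sum_mul]
    refine Finset.sum_congr rfl fun j _ => Finset.sum_congr rfl fun k _ => ?_
    ring
  rw [hdrift, hdiffusion, htr, hquad]
  ring
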